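/- Let X be a Peano continuum having a free arc, which is neither an arc nor a circle, and suppose that X has no maximal free open interval of Type I. If J is a maximal free open interval in X and f : X → X is a continuous open map, then there is a maximal free open interval K of X such that f(J) ⊆ K, and the restriction f : J → f(J) ⊆ K is injective. -/

import Mathlib

open Set Metric Topology

/-- The whole space `X` is an arc, i.e. homeomorphic to `[0,1]`. -/
def SpaceIsArc (X : Type*) [TopologicalSpace X] : Prop :=
  Nonempty (X ≃ₜ Set.Icc (0:ℝ) 1)

/-- The whole space `X` is a circle, i.e. homeomorphic to the unit circle in `ℂ`. -/
def SpaceIsCircle (X : Type*) [TopologicalSpace X] : Prop :=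
  Nonempty (X ≃ₜ Metric.sphere (0:ℂ) 1)

/-- A subset `A` is an arc: with the subspace topology it is homeomorphic to `[0,1]`. -/
def IsArc {X : Type*} [TopologicalSpace X] (A : Set X) : Prop :=
  Nonempty (A ≃ₜ Set.Icc (0:ℝ) 1)

/-- A subset `A` is a circle: with the subspace topology it is homeomorphic to `S¹`. -/
def IsCircleSet {X : Type*} [TopologicalSpace X] (A : Set X) : Prop :=
  Nonempty (A ≃ₜ Metric.sphere (0:ℂ) 1)

/-- `A` is an arc with endpoints `a` and `b`: it is the image of a continuous
injective parametrization of `[0,1]` with `γ 0 = a` and `γ 1 = b`. -/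
def IsArcEnds {X : Type*} [TopologicalSpace X] (A : Set X) (a b : X) : Prop :=
  ∃ γ : ℝ → X, ContinuousOn γ (Set.Icc 0 1) ∧ Set.InjOn γ (Set.Icc 0 1) ∧
    γ '' Set.Icc 0 1 = A ∧ γ 0 = a ∧ γ 1 = b

/-- A free open interval: an open subset homeomorphic to `(0,1)`. -/
def IsFreeOpenInterval {X : Type*} [TopologicalSpace X] (J : Set X) : Prop :=
  IsOpen J ∧ Nonempty (J ≃ₜ Set.Ioo (0:ℝ) 1)

/-- A free arc: the closure of a free open interval, homeomorphic to `[0,1]`. -/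
def IsFreeArc {X : Type*} [TopologicalSpace X] (A : Set X) : Prop :=
  ∃ J : Set X, IsFreeOpenInterval J ∧ A = closure J ∧ IsArc A

/-- A maximal free open interval: no free open interval properly contains it. -/
def IsMaxFreeOpenInterval {X : Type*} [TopologicalSpace X] (J : Set X) : Prop :=
  IsFreeOpenInterval J ∧ ∀ K : Set X, IsFreeOpenInterval K → J ⊆ K → J = K

/-- `x` is an endpoint of the space `X`: every open set containing `x` contains an
open neighborhood of `x` whose boundary is a single point. -/
def IsEndpointOf (X : Type*) [TopologicalSpace X] (x : X) : Prop :=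
  ∀ U : Set X, IsOpen U → x ∈ U → ∃ V : Set X, IsOpen V ∧ x ∈ V ∧ V ⊆ U ∧
    ∃ y : X, frontier V = {y}

/-- A maximal free open interval of Type I: its closure is an arc `J ∪ {a,b}` with
`a, b ∉ J` and at least one of `a, b` an endpoint of `X`. -/
def IsTypeI {X : Type*} [TopologicalSpace X] (J : Set X) : Prop :=
  IsMaxFreeOpenInterval J ∧ ∃ a b : X, a ≠ b ∧ a ∉ J ∧ b ∉ J ∧
    closure J = J ∪ {a, b} ∧ IsArcEnds (closure J) a b ∧
    (IsEndpointOf X a ∨ IsEndpointOf X b)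

/-- The model simple triod in the complex plane: three unit segments from the
origin in directions `π/3`, `π`, `5π/3`. -/
noncomputable def triodModel : Set ℂ :=
  ⋃ θ ∈ ({Real.pi / 3, Real.pi, 5 * Real.pi / 3} : Set ℝ),
    (fun r : ℝ => (r : ℂ) * Complex.exp (θ * Complex.I)) '' Set.Icc (0:ℝ) 1

/-- `A` is a simple triod. -/
def IsSimpleTriod {X : Type*} [TopologicalSpace X] (A : Set X) : Prop :=
  Nonempty (A ≃ₜ triodModel)

/-- `U` contains no simple triod. -/
def ContainsNoTriod {X : Type*} [TopologicalSpace X] (U : Set X) : Prop :=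
  ∀ A : Set X, A ⊆ U → ¬ IsSimpleTriod A

/-- The distance between two subsets of a metric space:
`d(S,T) = inf { dist s t | s ∈ S, t ∈ T }`. -/
noncomputable def setDist {X : Type*} [MetricSpace X] (S T : Set X) : ℝ :=
  sInf (Set.image2 dist S T)


section OpenCurves

variable {X : Type*} [TopologicalSpace X]

lemma image_Icc_eq_univ_of_mem_Ioo [T2Space X] [ConnectedSpace X] {g : ℝ → X}
    (hc : Continuous g) (ho : IsOpenMap g) {s t u : ℝ} (hu : u ∈ Ioo s t)
    (h : g s = g t) (hus : g u = g s) : g '' Icc s t = univ := by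
  have hS : g '' Icc s t = g '' Ioo s t := by
    refine Subset.antisymm ?_ (image_mono Ioo_subset_Icc_self)
    rintro _ ⟨x, hx, rfl⟩
    rcases eq_endpoints_or_mem_Ioo_of_mem_Icc hx with rfl | rfl | hx
    · exact ⟨u, hu, hus⟩
    · exact ⟨u, hu, hus.trans h⟩
    · exact ⟨x, hx, rfl⟩
  refine IsClopen.eq_univ ⟨(isCompact_Icc.image hc).isClosed, ?_⟩ ⟨g u, u, Ioo_subset_Icc_self hu, rfl⟩
  rw [hS]
  exact ho _ isOpen_Ioo

lemma image_Icc_eq_univ_of_left_meets [T2Space X] [ConnectedSpace X] {g : ℝ → X}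
    (hc : Continuous g) (ho : IsOpenMap g) {r s t : ℝ} (hrs : r < s) (hst : s < t)
    (h : g s = g t) (hne : ∀ u ∈ Ico r s, g u ≠ g s)
    (hm : ∃ u ∈ Ico r s, g u ∈ g '' Icc s t) : g '' Icc s t = univ := by
  have hcl : IsClosed (g '' Icc s t) := (isCompact_Icc.image hc).isClosed
  have key : ∀ u ∈ Ico r s, g u ∈ g '' Icc s t → g u ∈ g '' Ioo s t := by
    rintro u hu ⟨x, hx, hxu⟩
    rcases eq_endpoints_or_mem_Ioo_of_mem_Icc hx with rfl | rfl | hx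
    · exact absurd hxu.symm (hne u hu)
    · exact absurd (hxu.symm.trans h.symm) (hne u hu)
    · exact ⟨x, hx, hxu⟩
  have hsub : Ico r s ⊆ g ⁻¹' (g '' Ioo s t) := by
    refine isPreconnected_Ico.subset_left_of_subset_union
      (v := g ⁻¹' (g '' Icc s t)ᶜ) ((ho _ isOpen_Ioo).preimage hc) (hcl.isOpen_compl.preimage hc)
      ?_ ?_ ?_
    · refine disjoint_left.2 fun x hx hx' => hx' (image_mono Ioo_subset_Icc_self hx)
    · intro u hu
      by_cases hx : g u ∈ g '' Icc s t
      · exact Or.inl (key u hu hx)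
      · exact Or.inr hx
    · obtain ⟨u, hu, hx⟩ := hm
      exact ⟨u, hu, key u hu hx⟩
  have hS : g '' Icc s t = g '' Ioo r t := by
    refine Subset.antisymm ?_ ?_
    · rintro _ ⟨x, hx, rfl⟩
      rcases hx.2.eq_or_lt with rfl | hxt
      · exact ⟨s, ⟨hrs, hst⟩, h⟩
      · exact ⟨x, ⟨hrs.trans_le hx.1, hxt⟩, rfl⟩
    · rintro _ ⟨x, hx, rfl⟩
      rcases lt_or_ge x s with hxs | hxs
      · exact image_mono Ioo_subset_Icc_self (hsub ⟨hx.1.le, hxs⟩)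
      · exact ⟨x, ⟨hxs, hx.2.le⟩, rfl⟩
  refine IsClopen.eq_univ ⟨hcl, ?_⟩ ⟨g s, s, ⟨le_rfl, hst.le⟩, rfl⟩
  rw [hS]
  exact ho _ isOpen_Ioo

lemma eq_or_eq_of_image_eq [T2Space X] [ConnectedSpace X] {g : ℝ → X}
    (hc : Continuous g) (ho : IsOpenMap g) {a b s t u : ℝ} (hab : g '' Icc a b ≠ univ)
    (hs : s ∈ Icc a b) (ht : t ∈ Icc a b) (hst : s < t) (h : g s = g t)
    (hu : u ∈ Icc a b) (hus : g u = g s) : u = s ∨ u = t := by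
  by_contra! hne
  have main : ∀ x y z : ℝ, x ∈ Icc a b → z ∈ Icc a b → x < y → y < z → g x = g z → g y = g x →
      False := by
    intro x y z hx hz hxy hyz hxz hyx
    refine hab (univ_subset_iff.1 ?_)
    rw [← image_Icc_eq_univ_of_mem_Ioo hc ho ⟨hxy, hyz⟩ hxz hyx]
    exact image_mono (Icc_subset_Icc hx.1 hz.2)
  rcases lt_or_gt_of_ne hne.1 with h1 | h1
  · exact main u s t hu ht h1 hst (hus.trans h) hus.symm
  · rcases lt_or_gt_of_ne hne.2 with h2 | h2
    · exact main s u t hs ht h1 h2 h hus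
    · exact main s t u hs hu hst h2 hus.symm h.symm

lemma left_notMem_image [T2Space X] [ConnectedSpace X] {g : ℝ → X}
    (hc : Continuous g) (ho : IsOpenMap g) {a b s t u : ℝ} (hab : g '' Icc a b ≠ univ)
    (hs : s ∈ Icc a b) (ht : t ∈ Icc a b) (hst : s < t) (h : g s = g t)
    (hu : u ∈ Ico a s) : g u ∉ g '' Icc s t := by
  intro hmem
  refine hab (univ_subset_iff.1 ?_)
  rw [← image_Icc_eq_univ_of_left_meets hc ho (hu.1.trans_lt hu.2) hst h ?_ ⟨u, hu, hmem⟩]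
  · exact image_mono (Icc_subset_Icc hs.1 ht.2)
  · intro x hx hxs
    rcases eq_or_eq_of_image_eq hc ho hab hs ht hst h ⟨hx.1, hx.2.le.trans hs.2⟩ hxs with rfl | rfl
    · exact lt_irrefl _ hx.2
    · exact lt_asymm hst hx.2

lemma right_notMem_image [T2Space X] [ConnectedSpace X] {g : ℝ → X}
    (hc : Continuous g) (ho : IsOpenMap g) {a b s t u : ℝ} (hab : g '' Icc a b ≠ univ)
    (hs : s ∈ Icc a b) (ht : t ∈ Icc a b) (hst : s < t) (h : g s = g t)
    (hu : u ∈ Ioc t b) : g u ∉ g '' Icc s t := by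
  have himg : ∀ x y : ℝ, (g ∘ Neg.neg) '' Icc (-y) (-x) = g '' Icc x y := by
    intro x y
    rw [image_comp]
    simp
  have := left_notMem_image (g := g ∘ Neg.neg) (a := -b) (b := -a) (s := -t) (t := -s) (u := -u)
    (hc.comp continuous_neg) (ho.comp (Homeomorph.neg ℝ).isOpenMap)
    (by rwa [himg]) ⟨neg_le_neg ht.2, neg_le_neg ht.1⟩ ⟨neg_le_neg hs.2, neg_le_neg hs.1⟩
    (neg_lt_neg hst) (by simpa using h.symm) ⟨neg_le_neg hu.2, neg_lt_neg hu.1⟩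
  rw [himg] at this
  simpa using this

/-- A fold: if an open curve is not injective on a short interval, then it folds at some point. -/
lemma exists_fold [T2Space X] [ConnectedSpace X] {g : ℝ → X}
    (hc : Continuous g) (ho : IsOpenMap g) {a b s t : ℝ} (hab : g '' Icc a b ≠ univ)
    (hs : a < s) (hst : s < t) (ht : t < b) (h : g s = g t) :
    ∃ T, s < T ∧ InjOn g (Icc s T) ∧ IsOpen (g '' Ioc s T) := by
  have hs' : s ∈ Icc a b := ⟨hs.le, (hst.trans ht).le⟩
  have ht' : t ∈ Icc a b := ⟨(hs.trans hst).le, ht.le⟩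
  set P : Set ℝ := {u | u ∈ Ioo a b ∧ ∃ v ∈ Ioo a b, u < v ∧ g v = g u} with hP
  set Q : Set ℝ := {u | u ∈ Ioo a b ∧ ∃ v ∈ Ioo a b, v < u ∧ g v = g u} with hQ
  have near : ∀ u v : ℝ, g v = g u → ∀ O : Set ℝ, IsOpen O → v ∈ O →
      ∀ᶠ x in 𝓝 u, ∃ y ∈ O, g y = g x := by
    intro u v huv O hO hv
    have : g '' O ∈ 𝓝 (g u) := (ho O hO).mem_nhds ⟨v, hv, huv⟩
    exact hc.continuousAt this
  have hPo : IsOpen P := by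
    rw [isOpen_iff_eventually]
    rintro u ⟨hu, v, hv, huv, hg⟩
    obtain ⟨m, hm1, hm2⟩ := exists_between huv
    filter_upwards [near u v hg (Ioo m b) isOpen_Ioo ⟨hm2, hv.2⟩, isOpen_Ioo.mem_nhds hu,
      isOpen_Iio.mem_nhds hm1] with x ⟨y, hy, hyx⟩ hx hxm
    exact ⟨hx, y, ⟨hx.1.trans (hxm.trans hy.1), hy.2⟩, hxm.trans hy.1, hyx⟩
  have hQo : IsOpen Q := by
    rw [isOpen_iff_eventually]
    rintro u ⟨hu, v, hv, huv, hg⟩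
    obtain ⟨m, hm1, hm2⟩ := exists_between huv
    filter_upwards [near u v hg (Ioo a m) isOpen_Ioo ⟨hv.1, hm1⟩, isOpen_Ioo.mem_nhds hu,
      isOpen_Ioi.mem_nhds hm2] with x ⟨y, hy, hyx⟩ hx hxm
    exact ⟨hx, y, ⟨hy.1, (hy.2.trans hxm).trans hx.2⟩, hy.2.trans hxm, hyx⟩
  have hPQ : Disjoint P Q := by
    rw [disjoint_left]
    rintro u ⟨hu, v, hv, huv, hg⟩ ⟨-, w, hw, hwu, hg'⟩
    rcases eq_or_eq_of_image_eq hc ho hab (Ioo_subset_Icc_self hw) (Ioo_subset_Icc_self hu) hwu hg'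
      (Ioo_subset_Icc_self hv) (hg.trans hg'.symm) with rfl | rfl
    · exact lt_asymm hwu huv
    · exact lt_irrefl _ huv
  have hsP : s ∈ P := ⟨⟨hs, hst.trans ht⟩, t, ⟨hs.trans hst, ht⟩, hst, h.symm⟩
  have htQ : t ∈ Q := ⟨⟨hs.trans hst, ht⟩, s, ⟨hs, hst.trans ht⟩, hst, h⟩
  have hFne : (Icc s t \ (P ∪ Q)).Nonempty := by
    by_contra hemp
    rw [not_nonempty_iff_eq_empty, sdiff_eq_empty] at hemp
    rcases isPreconnected_Icc.subset_or_subset hPo hQo hPQ hemp with h1 | h1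
    · exact disjoint_left.1 hPQ (h1 ⟨hst.le, le_rfl⟩) htQ
    · exact disjoint_left.1 hPQ hsP (h1 ⟨le_rfl, hst.le⟩)
  have hFc : IsCompact (Icc s t \ (P ∪ Q)) := isCompact_Icc.diff (hPo.union hQo)
  obtain ⟨T, ⟨hT, hTPQ⟩, hTleast⟩ := hFc.exists_isLeast hFne
  have hsT : s < T := hT.1.lt_of_ne (by rintro rfl; exact hTPQ (Or.inl hsP))
  have hTt : T < t := hT.2.lt_of_ne (by rintro rfl; exact hTPQ (Or.inr htQ))
  have hTab : T ∈ Ioo a b := ⟨hs.trans hsT, hTt.trans ht⟩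
  have hTno : ∀ v ∈ Ioo a b, g v = g T → v = T := by
    intro v hv hvT
    by_contra hne
    rcases lt_or_gt_of_ne hne with h1 | h1
    · exact hTPQ (Or.inr ⟨hTab, v, hv, h1, hvT⟩)
    · exact hTPQ (Or.inl ⟨hTab, v, hv, h1, hvT⟩)
  have hIcoP : Ico s T ⊆ P := by
    refine isPreconnected_Ico.subset_left_of_subset_union hPo hQo hPQ ?_ ⟨s, ⟨le_rfl, hsT⟩, hsP⟩
    intro x hx
    by_contra hx'
    exact absurd (hTleast ⟨⟨hx.1, hx.2.le.trans hT.2⟩, hx'⟩) (not_le.2 hx.2)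
  have partner : ∀ x ∈ Ico s T, ∃ y ∈ Ioc T t, g y = g x := by
    intro x hx
    obtain ⟨hxab, y, hy, hxy, hg⟩ := hIcoP hx
    refine ⟨y, ⟨?_, ?_⟩, hg⟩
    · by_contra! hyT
      rcases hyT.eq_or_lt with rfl | hyT
      · exact hx.2.ne (hTno x hxab hg.symm)
      · exact disjoint_left.1 hPQ (hIcoP ⟨hx.1.trans hxy.le, hyT⟩) ⟨hy, x, hxab, hxy, hg.symm⟩
    · by_contra! hyt
      exact right_notMem_image hc ho hab hs' ht' hst h ⟨hyt, hy.2.le⟩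
        ⟨x, ⟨hx.1, hx.2.le.trans hT.2⟩, hg.symm⟩
  have hinj : InjOn g (Icc s T) := by
    have aux : ∀ x ∈ Icc s T, ∀ y ∈ Icc s T, g x = g y → ¬ x < y := by
      intro x hx y hy hxy hlt
      obtain ⟨z, hz, hzx⟩ := partner x ⟨hx.1, hlt.trans_le hy.2⟩
      have hm : ∀ w ∈ Icc s t, w ∈ Icc a b := fun w hw => ⟨hs.le.trans hw.1, hw.2.trans ht.le⟩
      rcases eq_or_eq_of_image_eq hc ho hab (hm x ⟨hx.1, hx.2.trans hT.2⟩)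
        (hm y ⟨hy.1, hy.2.trans hT.2⟩) hlt hxy (hm z ⟨hT.1.trans hz.1.le, hz.2⟩) hzx with rfl | rfl
      · exact not_lt.2 hx.2 hz.1
      · exact not_lt.2 hy.2 hz.1
    intro x hx y hy hxy
    exact le_antisymm (not_lt.1 (aux y hy x hx hxy.symm)) (not_lt.1 (aux x hx y hy hxy))
  refine ⟨T, hsT, hinj, ?_⟩
  have hRL : Ioo T t ⊆ g ⁻¹' (g '' Ioo s T) := by
    refine isPreconnected_Ioo.subset_left_of_subset_union
      (v := g ⁻¹' (g '' Icc s T)ᶜ) ((ho _ isOpen_Ioo).preimage hc)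
      ((isCompact_Icc.image hc).isClosed.isOpen_compl.preimage hc) ?_ ?_ ?_
    · exact disjoint_left.2 fun x hx hx' => hx' (image_mono Ioo_subset_Icc_self hx)
    · intro y hy
      by_cases hmem : g y ∈ g '' Icc s T
      · left
        obtain ⟨x, hx, hxy⟩ := hmem
        have hyab : y ∈ Ioo a b := ⟨hTab.1.trans hy.1, hy.2.trans ht⟩
        rcases eq_endpoints_or_mem_Ioo_of_mem_Icc hx with rfl | rfl | hx
        · rcases eq_or_eq_of_image_eq hc ho hab hs' ht' hst h (Ioo_subset_Icc_self hyab) hxy.symm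
            with rfl | rfl
          · exact absurd hy.1 (not_lt.2 hsT.le)
          · exact absurd hy.2 (lt_irrefl _)
        · exact absurd (hTno y hyab hxy.symm) hy.1.ne'
        · exact ⟨x, hx, hxy⟩
      · exact Or.inr hmem
    · obtain ⟨m, hm1, hm2⟩ := exists_between hsT
      obtain ⟨y, hy, hym⟩ := partner m ⟨hm1.le, hm2⟩
      refine ⟨y, ⟨hy.1, hy.2.lt_of_ne ?_⟩, m, ⟨hm1, hm2⟩, hym.symm⟩
      rintro rfl
      exact hm1.ne (hinj ⟨le_rfl, hsT.le⟩ ⟨hm1.le, hm2.le⟩ (h.trans hym))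
  have : g '' Ioc s T = g '' Ioo s t := by
    refine Subset.antisymm (image_mono fun x hx => ⟨hx.1, hx.2.trans_lt hTt⟩) ?_
    rintro _ ⟨x, hx, rfl⟩
    rcases le_or_gt x T with hxT | hxT
    · exact ⟨x, ⟨hx.1, hxT⟩, rfl⟩
    · exact image_mono Ioo_subset_Ioc_self (hRL ⟨hxT, hx.2⟩)
  rw [this]
  exact ho _ isOpen_Ioo

/-- An open curve that is locally injective but not injective covers a circle. -/
lemma spaceIsCircle_of_not_injective [T2Space X] [ConnectedSpace X]
    {g : ℝ → X} (hc : Continuous g) (ho : IsOpenMap g)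
    (hloc : ∀ p : ℝ, ∃ O, IsOpen O ∧ p ∈ O ∧ InjOn g O)
    (hninj : ¬ Function.Injective g) : Nonempty (X ≃ₜ Metric.sphere (0:ℂ) 1) := by
  obtain ⟨s₀, t₀, hst₀, h₀⟩ : ∃ s t : ℝ, s < t ∧ g s = g t := by
    simp only [Function.Injective, not_forall] at hninj
    obtain ⟨x, y, hxy, hne⟩ := hninj
    rcases lt_or_gt_of_ne hne with h | h
    · exact ⟨x, y, h, hxy⟩
    · exact ⟨y, x, h, hxy.symm⟩
  set D : Set (ℝ × ℝ) := {p | p.1 < p.2 ∧ g p.1 = g p.2} with hD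
  have hDc : IsClosed D := by
    have : D = {p : ℝ × ℝ | p.1 ≤ p.2} ∩ {p | g p.1 = g p.2} ∩
        (⋃ O ∈ {O : Set ℝ | IsOpen O ∧ InjOn g O}, O ×ˢ O)ᶜ := by
      ext ⟨x, y⟩
      simp only [hD, mem_ofPred_eq, mem_inter_iff, mem_compl_iff, mem_iUnion, mem_prod, not_exists]
      constructor
      · rintro ⟨h1, h2⟩
        exact ⟨⟨h1.le, h2⟩, fun O hO hxy => h1.ne (hO.2 hxy.1 hxy.2 h2)⟩
      · rintro ⟨⟨h1, h2⟩, h3⟩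
        refine ⟨h1.lt_of_ne ?_, h2⟩
        rintro rfl
        obtain ⟨O, hO, hx, hi⟩ := hloc x
        exact h3 O ⟨hO, hi⟩ ⟨hx, hx⟩
    rw [this]
    refine ((isClosed_le continuous_fst continuous_snd).inter
      (isClosed_eq (hc.comp continuous_fst) (hc.comp continuous_snd))).inter ?_
    exact (isOpen_biUnion fun O hO => hO.1.prod hO.1).isClosed_compl
  have hKc : IsCompact (Icc s₀ t₀ ×ˢ Icc s₀ t₀ ∩ D) := (isCompact_Icc.prod isCompact_Icc).inter_right hDc
  obtain ⟨⟨s, t⟩, ⟨⟨hs, ht⟩, hst, h⟩, hmin⟩ := hKc.exists_isMinOn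
    ⟨(s₀, t₀), ⟨⟨le_rfl, hst₀.le⟩, ⟨hst₀.le, le_rfl⟩⟩, hst₀, h₀⟩
    (f := fun p : ℝ × ℝ => p.2 - p.1) (by fun_prop)
  dsimp only at hs ht hst h
  have hinj : InjOn g (Ico s t) := by
    have aux : ∀ x ∈ Ico s t, ∀ y ∈ Ico s t, g x = g y → ¬ x < y := by
      intro x hx y hy hxy hlt
      have := hmin (a := (x, y)) ⟨⟨⟨hs.1.trans hx.1, hx.2.le.trans ht.2⟩,
        ⟨hs.1.trans hy.1, hy.2.le.trans ht.2⟩⟩, hlt, hxy⟩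
      simp only [mem_ofPred_eq] at this
      linarith [hx.1, hy.2]
    intro x hx y hy hxy
    exact le_antisymm (not_lt.1 (aux y hy x hx hxy.symm)) (not_lt.1 (aux x hx y hy hxy))
  have huniv : g '' Icc s t = univ := by
    obtain ⟨O, hO, hsO, hi⟩ := hloc s
    obtain ⟨ε, hε, hball⟩ := Metric.isOpen_iff.1 hO s hsO
    rw [Real.ball_eq_Ioo] at hball
    set r := s - ε / 2 with hr
    have hIco : ∀ u ∈ Ico r s, u ∈ O := fun u hu => hball ⟨by linarith [hu.1], by linarith [hu.2]⟩
    set d := min (ε / 2) ((t - s) / 2) with hd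
    have hd0 : 0 < d := lt_min (by linarith) (by linarith)
    have hd1 : d ≤ ε / 2 := min_le_left _ _
    have hd2 : d ≤ (t - s) / 2 := min_le_right _ _
    refine image_Icc_eq_univ_of_left_meets hc ho (r := r) (by linarith) hst h ?_ ?_
    · intro u hu hus
      exact hu.2.ne (hi (hIco u hu) hsO hus)
    · have hN : g '' Ioo (s - d) (s + d) ∈ 𝓝 (g t) :=
        (ho _ isOpen_Ioo).mem_nhds ⟨s, ⟨by linarith, by linarith⟩, h⟩
      have hev : ∀ᶠ x in 𝓝[<] t, x ∈ Ioo (s + d) t ∧ g x ∈ g '' Ioo (s - d) (s + d) := by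
        filter_upwards [Ioo_mem_nhdsLT (show s + d < t by linarith),
          nhdsWithin_le_nhds (hc.continuousAt hN)] with x hx hx'
        exact ⟨hx, hx'⟩
      obtain ⟨x, hx, u, hu, hux⟩ := hev.exists
      refine ⟨u, ⟨by linarith [hu.1], ?_⟩, x, ⟨by linarith [hx.1], hx.2.le⟩, hux.symm⟩
      by_contra! hsu
      have := hinj ⟨hsu, by linarith [hu.2]⟩ ⟨by linarith [hx.1], hx.2⟩ hux
      linarith [hu.2, hx.1]
  have : Fact (0 < t - s) := ⟨by linarith⟩
  have hcont : Continuous (AddCircle.liftIco (t - s) s g) :=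
    AddCircle.liftIco_continuous (by rw [add_sub_cancel, h]) hc.continuousOn
  have hco : ∀ z : AddCircle (t - s), ∃ x ∈ Ico s t, (x : AddCircle (t - s)) = z := by
    intro z
    refine ⟨AddCircle.equivIco (t - s) s z, ?_, AddCircle.coe_equivIco⟩
    have := (AddCircle.equivIco (t - s) s z).2
    exact ⟨this.1, by linarith [this.2]⟩
  have happ : ∀ x ∈ Ico s t, AddCircle.liftIco (t - s) s g (x : AddCircle (t - s)) = g x :=
    fun x hx => AddCircle.liftIco_coe_apply (by rwa [add_sub_cancel])
  have hbij : Function.Bijective (AddCircle.liftIco (t - s) s g) := by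
    constructor
    · intro z w hzw
      obtain ⟨x, hx, rfl⟩ := hco z
      obtain ⟨y, hy, rfl⟩ := hco w
      rw [happ x hx, happ y hy] at hzw
      rw [hinj hx hy hzw]
    · intro z
      obtain ⟨x, hx, rfl⟩ : z ∈ g '' Icc s t := huniv ▸ mem_univ z
      rcases hx.2.eq_or_lt with rfl | hxt
      · exact ⟨s, (happ s ⟨le_rfl, hst⟩).trans h⟩
      · exact ⟨x, happ x ⟨hx.1, hxt⟩⟩
  let e : AddCircle (t - s) ≃ₜ X :=
    Continuous.homeoOfEquivCompactToT2 (f := Equiv.ofBijective _ hbij) hcont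
  have e' : AddCircle (t - s) ≃ₜ Metric.sphere (0:ℂ) 1 :=
    AddCircle.homeomorphCircle (by linarith)
  exact ⟨e.symm.trans e'⟩

end OpenCurves

section FreeOpenIntervals

lemma exists_isOpenEmbedding_range_eq_Ioo {a b : ℝ} (hab : a < b) :
    ∃ e : ℝ → ℝ, IsOpenEmbedding e ∧ range e = Ioo a b := by
  have hπ := Real.pi_pos
  have hba : 0 < b - a := sub_pos.2 hab
  let A : ℝ → ℝ := fun x => (b - a) / Real.pi * x + (a + b) / 2
  have hA : StrictMono A := by
    intro x y hxy
    have : 0 < (b - a) / Real.pi := by positivity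
    simp only [A]
    gcongr
  have hr : range (A ∘ Real.arctan) = Ioo a b := by
    rw [range_comp, Real.range_arctan]
    simp only [A]
    rw [← image_image (fun x => x + (a + b) / 2) (fun x => (b - a) / Real.pi * x),
      image_mul_left_Ioo (by positivity), image_add_const_Ioo]
    congr 1 <;> field_simp <;> ring
  refine ⟨A ∘ Real.arctan, ⟨(hA.comp Real.arctan_strictMono).isEmbedding_of_ordConnected ?_, ?_⟩, hr⟩
  · rw [hr]; exact ordConnected_Ioo
  · rw [hr]; exact isOpen_Ioo

variable {X : Type*} [TopologicalSpace X]

lemma isFreeOpenInterval_iff {J : Set X} :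
    IsFreeOpenInterval J ↔ ∃ γ : ℝ → X, IsOpenEmbedding γ ∧ range γ = J := by
  obtain ⟨e, he, hr⟩ := exists_isOpenEmbedding_range_eq_Ioo (zero_lt_one (α := ℝ))
  let E : ℝ ≃ₜ Ioo (0:ℝ) 1 := he.isEmbedding.toHomeomorph.trans (Homeomorph.setCongr hr)
  constructor
  · rintro ⟨hJ, ⟨φ⟩⟩
    refine ⟨fun x => (φ.symm (E x) : X), ?_, ?_⟩
    · exact hJ.isOpenEmbedding_subtypeVal.comp (E.trans φ.symm).isOpenEmbedding
    · have := (E.trans φ.symm).surjective.range_comp (Subtype.val : J → X)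
      rw [Subtype.range_val] at this
      exact this
  · rintro ⟨γ, hγ, rfl⟩
    exact ⟨hγ.isOpen_range, ⟨hγ.isEmbedding.toHomeomorph.symm.trans E⟩⟩

lemma isFreeOpenInterval_image_Ioo {g : ℝ → X} (hc : Continuous g) (ho : IsOpenMap g) {s t : ℝ}
    (hst : s < t) (hinj : InjOn g (Ioo s t)) : IsFreeOpenInterval (g '' Ioo s t) := by
  obtain ⟨e, he, hr⟩ := exists_isOpenEmbedding_range_eq_Ioo hst
  refine isFreeOpenInterval_iff.2 ⟨g ∘ e, ?_, by rw [range_comp, hr]⟩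
  refine IsOpenEmbedding.of_continuous_injective_isOpenMap (hc.comp he.continuous) ?_
    (ho.comp he.isOpenMap)
  intro x y hxy
  exact he.injective (hinj (hr ▸ mem_range_self x) (hr ▸ mem_range_self y) hxy)

lemma isOpenEmbedding_of_continuous_injective {h : ℝ → ℝ} (hc : Continuous h)
    (hi : Function.Injective h) : IsOpenEmbedding h := by
  have hmono : ∀ k : ℝ → ℝ, Continuous k → StrictMono k → IsOpenMap k := by
    intro k hk hm
    refine IsOpenMap.of_nhds_le fun x => ?_
    intro S hS
    rw [Filter.mem_map] at hS
    obtain ⟨ε, hε, hb⟩ := Metric.mem_nhds_iff.1 hS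
    have h1 : Icc (k (x - ε / 2)) (k (x + ε / 2)) ⊆ S := by
      refine (intermediate_value_Icc (by linarith) hk.continuousOn).trans ?_
      rintro _ ⟨y, hy, rfl⟩
      refine hb ?_
      rw [Real.ball_eq_Ioo]
      exact ⟨by linarith [hy.1], by linarith [hy.2]⟩
    exact Filter.mem_of_superset (Icc_mem_nhds (hm (by linarith)) (hm (by linarith))) h1
  refine IsOpenEmbedding.of_continuous_injective_isOpenMap hc hi ?_
  rcases hc.strictMono_of_inj hi with hm | hm
  · exact hmono h hc hm
  · have h1 := hmono (h ∘ Neg.neg) (hc.comp continuous_neg) (fun x y hxy => hm (neg_lt_neg hxy))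
    have h2 := h1.comp (Homeomorph.neg ℝ).isOpenMap
    convert h2 using 1
    ext x
    simp

lemma IsFreeOpenInterval.nonempty {J : Set X} (hJ : IsFreeOpenInterval J) : J.Nonempty := by
  obtain ⟨γ, -, rfl⟩ := isFreeOpenInterval_iff.1 hJ
  exact range_nonempty γ

lemma IsFreeOpenInterval.isPreconnected {J : Set X} (hJ : IsFreeOpenInterval J) :
    IsPreconnected J := by
  obtain ⟨γ, hγ, rfl⟩ := isFreeOpenInterval_iff.1 hJ
  exact isPreconnected_range hγ.continuous

/-- A nonempty preconnected union of free open intervals that injects continuously into the line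
is a free open interval. -/
lemma isFreeOpenInterval_of_injOn {U : Set X} (hne : U.Nonempty) (hU : IsPreconnected U)
    (hcov : ∀ x ∈ U, ∃ K, IsFreeOpenInterval K ∧ x ∈ K ∧ K ⊆ U)
    {F : X → ℝ} (hF : ContinuousOn F U) (hFi : InjOn F U) : IsFreeOpenInterval U := by
  have hUo : IsOpen U := by
    rw [isOpen_iff_mem_nhds]
    intro x hx
    obtain ⟨K, hK, hxK, hKU⟩ := hcov x hx
    exact Filter.mem_of_superset (hK.1.mem_nhds hxK) hKU
  have hat : ∀ x, Real.arctan x ∈ Icc (-(Real.pi / 2)) (Real.pi / 2) := fun x =>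
    ⟨(Real.neg_pi_div_two_lt_arctan x).le, (Real.arctan_lt_pi_div_two x).le⟩
  set G : U → ℝ := fun x => Real.arctan (F x) with hG
  have hGc : Continuous G := Real.continuous_arctan.comp (continuousOn_iff_continuous_domRestrict.1 hF)
  have hGi : Function.Injective G := fun x y hxy =>
    Subtype.ext (hFi x.2 y.2 (Real.arctan_injective hxy))
  have hGo : IsOpenMap G := by
    refine IsOpenMap.of_nhds_le fun x => ?_
    obtain ⟨K, hK, hxK, hKU⟩ := hcov x x.2
    obtain ⟨γ, hγ, rfl⟩ := isFreeOpenInterval_iff.1 hK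
    obtain ⟨r, hr⟩ := hxK
    let δ : ℝ → U := fun y => ⟨γ y, hKU ⟨y, rfl⟩⟩
    have hδ : Continuous δ := hγ.continuous.subtype_mk _
    have hδi : Function.Injective δ := fun y z hyz => hγ.injective (congrArg Subtype.val hyz)
    have hδr : δ r = x := Subtype.ext hr
    have ho := (isOpenEmbedding_of_continuous_injective (hGc.comp hδ) (hGi.comp hδi)).isOpenMap
    have h1 : 𝓝 (G x) ≤ Filter.map (G ∘ δ) (𝓝 r) := by
      have := ho.nhds_le r
      rwa [Function.comp_apply, hδr] at this
    refine h1.trans ?_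
    rw [← Filter.map_map]
    refine Filter.map_mono ?_
    have := hδ.continuousAt (x := r)
    rwa [ContinuousAt, hδr] at this
  have hGe : IsOpenEmbedding G := .of_continuous_injective_isOpenMap hGc hGi hGo
  have : Nonempty U := hne.to_subtype
  have : PreconnectedSpace U := isPreconnected_iff_preconnectedSpace.1 hU
  have hpre : IsPreconnected (range G) := isPreconnected_range hGc
  have hbb : BddBelow (range G) := ⟨-(Real.pi / 2), by rintro _ ⟨x, rfl⟩; exact (hat _).1⟩
  have hba : BddAbove (range G) := ⟨Real.pi / 2, by rintro _ ⟨x, rfl⟩; exact (hat _).2⟩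
  have hrange : range G = Ioo (sInf (range G)) (sSup (range G)) := by
    refine Subset.antisymm ?_ ?_
    · have h1 : range G ⊆ Icc (sInf (range G)) (sSup (range G)) := fun y hy =>
        ⟨csInf_le hbb hy, le_csSup hba hy⟩
      have h2 := interior_mono h1
      rwa [hGe.isOpen_range.interior_eq, interior_Icc] at h2
    · exact (show IsConnected (range G) from ⟨range_nonempty G, hpre⟩).Ioo_csInf_csSup_subset hbb hba
  have hlt : sInf (range G) < sSup (range G) := by
    obtain ⟨y, hy⟩ := range_nonempty G
    rw [hrange] at hy
    exact hy.1.trans hy.2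
  obtain ⟨e, he, hr⟩ := exists_isOpenEmbedding_range_eq_Ioo hlt
  let H : U ≃ₜ ℝ := hGe.isEmbedding.toHomeomorph.trans
    ((Homeomorph.setCongr (hrange.trans hr.symm)).trans he.isEmbedding.toHomeomorph.symm)
  refine isFreeOpenInterval_iff.2 ⟨Subtype.val ∘ H.symm,
    hUo.isOpenEmbedding_subtypeVal.comp H.symm.isOpenEmbedding, ?_⟩
  rw [H.symm.surjective.range_comp, Subtype.range_val]

lemma exists_injective_extension {h : ℝ → ℝ} {c d : ℝ} (hcd : c ≤ d)
    (hc : ContinuousOn h (Icc c d)) (hi : InjOn h (Icc c d)) :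
    ∃ H : ℝ → ℝ, Continuous H ∧ Function.Injective H ∧ EqOn H h (Icc c d) := by
  have key : ∀ k : ℝ → ℝ, ContinuousOn k (Icc c d) → StrictMonoOn k (Icc c d) →
      ∃ H : ℝ → ℝ, Continuous H ∧ Function.Injective H ∧ EqOn H k (Icc c d) := by
    intro k hk hm
    have hpm : ∀ x, (projIcc c d hcd x : ℝ) ∈ Icc c d := fun x => (projIcc c d hcd x).2
    refine ⟨fun x => k (projIcc c d hcd x) + (x - projIcc c d hcd x), ?_, ?_, ?_⟩
    · have : Continuous fun x => k (projIcc c d hcd x) :=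
        (continuousOn_iff_continuous_domRestrict.1 hk).comp continuous_projIcc
      have h2 : Continuous fun x => (projIcc c d hcd x : ℝ) :=
        continuous_subtype_val.comp continuous_projIcc
      exact this.add (continuous_id.sub h2)
    · refine StrictMono.injective fun x y hxy => ?_
      have hle : (projIcc c d hcd x : ℝ) ≤ projIcc c d hcd y := monotone_projIcc hcd hxy.le
      have h1 : x - projIcc c d hcd x ≤ y - projIcc c d hcd y := by
        simp only [coe_projIcc]
        rcases le_total d x with h1 | h1 <;> rcases le_total d y with h2 | h2 <;>
          rcases le_total c x with h3 | h3 <;> rcases le_total c y with h4 | h4 <;>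
          simp [*] <;> linarith
      rcases hle.lt_or_eq with hlt | heq
      · have := hm (hpm x) (hpm y) hlt
        linarith
      · rw [heq]
        linarith
    · intro x hx
      simp [projIcc_of_mem hcd hx]
  rcases hc.strictMonoOn_of_injOn_Icc' hcd hi with hm | hm
  · exact key h hc hm
  · obtain ⟨H, h1, h2, h3⟩ := key (fun x => - h x) hc.neg hm.neg
    refine ⟨fun x => - H x, h1.neg, neg_injective.comp h2, fun x hx => ?_⟩
    simp [h3 hx]

lemma IsFreeOpenInterval.exists_injOn_extension {K K' : Set X}
    (hK : IsFreeOpenInterval K) (hK' : IsFreeOpenInterval K') (hKK' : K ⊆ K') {D : Set X}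
    (hD : IsCompact D) (hDK : D ⊆ K) {g : X → ℝ} (hg : ContinuousOn g K)
    (hgi : InjOn g K) :
    ∃ g' : X → ℝ, ContinuousOn g' K' ∧ InjOn g' K' ∧ EqOn g' g D := by
  obtain ⟨γ, hγ, rfl⟩ := isFreeOpenInterval_iff.1 hK'
  have hA : γ '' (γ ⁻¹' K) = K := by rw [image_preimage_eq_inter_range, inter_eq_left.2 hKK']
  have hApre : IsPreconnected (γ ⁻¹' K) := by
    rw [← hγ.isInducing.isPreconnected_image, hA]
    exact hK.isPreconnected
  have hEc : IsCompact (γ ⁻¹' D) := by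
    rw [hγ.isInducing.isCompact_iff, image_preimage_eq_inter_range,
      inter_eq_left.2 (hDK.trans hKK')]
    exact hD
  obtain ⟨p, hp⟩ : (γ ⁻¹' K).Nonempty := by
    obtain ⟨x, hx⟩ := hK.nonempty
    obtain ⟨p, rfl⟩ := hKK' hx
    exact ⟨p, hx⟩
  have hE' : IsCompact (insert p (γ ⁻¹' D)) := hEc.insert p
  have hE'A : insert p (γ ⁻¹' D) ⊆ γ ⁻¹' K := insert_subset hp (preimage_mono hDK)
  obtain ⟨c, hc⟩ := hE'.exists_isLeast ⟨p, mem_insert _ _⟩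
  obtain ⟨d, hd⟩ := hE'.exists_isGreatest ⟨p, mem_insert _ _⟩
  have hsub : Icc c d ⊆ γ ⁻¹' K := hApre.Icc_subset (hE'A hc.1) (hE'A hd.1)
  obtain ⟨H, h1, h2, h3⟩ := exists_injective_extension (h := g ∘ γ) (hc.2 hd.1)
    (hg.comp hγ.continuous.continuousOn hsub)
    (fun x hx y hy hxy => hγ.injective (hgi (hsub hx) (hsub hy) hxy))
  have hinv : ∀ x, Function.invFun γ (γ x) = x := Function.leftInverse_invFun hγ.injective
  refine ⟨H ∘ Function.invFun γ, ?_, ?_, ?_⟩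
  · rintro _ ⟨x, rfl⟩
    refine ContinuousAt.continuousWithinAt ?_
    rw [← hγ.continuousAt_iff]
    have : (H ∘ Function.invFun γ) ∘ γ = H := by
      ext x
      simp [hinv]
    rw [this]
    exact h1.continuousAt
  · rintro _ ⟨x, rfl⟩ _ ⟨y, rfl⟩ hxy
    simp only [Function.comp_apply, hinv] at hxy
    rw [h2 hxy]
  · intro x hx
    obtain ⟨y, rfl⟩ := hKK' (hDK hx)
    simp only [Function.comp_apply, hinv]
    exact h3 ⟨hc.2 (mem_insert_of_mem _ hx), hd.2 (mem_insert_of_mem _ hx)⟩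

end FreeOpenIntervals

section MaximalFreeOpenIntervals

variable {X : Type*}

lemma isFreeOpenInterval_sUnion_of_isChain [MetricSpace X] [CompactSpace X] {c : Set (Set X)}
    (hc : ∀ K ∈ c, IsFreeOpenInterval K) (hchain : IsChain (· ⊆ ·) c) (hne : c.Nonempty) :
    IsFreeOpenInterval (⋃₀ c) := by
  have hUo : IsOpen (⋃₀ c) := isOpen_sUnion fun K hK => (hc K hK).1
  have hcompact : ∀ D : Set X, IsCompact D → D ⊆ ⋃₀ c → ∃ K ∈ c, D ⊆ K := by
    intro D hD hDU
    have : Nonempty c := hne.to_subtype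
    obtain ⟨K, hK⟩ := hD.elim_directed_cover (fun K : c => (K : Set X)) (fun K => (hc K K.2).1)
      (by rwa [← sUnion_eq_iUnion]) hchain.directed
    exact ⟨K, K.2, hK⟩
  have hlc : LocallyCompactSpace (⋃₀ c : Set X) := hUo.locallyCompactSpace
  let E := CompactExhaustion.choice (⋃₀ c : Set X)
  set D : ℕ → Set X := fun n => Subtype.val '' E n with hD
  have hDc : ∀ n, IsCompact (D n) := fun n => (E.isCompact n).image continuous_subtype_val
  have hDU : ∀ n, D n ⊆ ⋃₀ c := by
    rintro n _ ⟨x, -, rfl⟩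
    exact x.2
  have hDmono : Monotone D := fun m n hmn => image_mono (E.subset hmn)
  have hDnhds : ∀ x ∈ ⋃₀ c, ∃ n, D n ∈ 𝓝 x := by
    intro x hx
    obtain ⟨n, hn⟩ := E.exists_mem_nhds ⟨x, hx⟩
    exact ⟨n, (hUo.isOpenMap_subtype_val).image_mem_nhds hn⟩
  let S : ℕ → Type _ := fun n => {p : Set X × (X → ℝ) //
    p.1 ∈ c ∧ D n ⊆ p.1 ∧ ContinuousOn p.2 p.1 ∧ InjOn p.2 p.1}
  have hstep : ∀ n (p : S n), ∃ q : S (n + 1), EqOn q.1.2 p.1.2 (D n) := by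
    rintro n ⟨⟨K, g⟩, hK, hDK, hg, hgi⟩
    obtain ⟨K₁, hK₁, hDK₁⟩ := hcompact _ (hDc (n + 1)) (hDU (n + 1))
    obtain ⟨K', hK', h1, h2⟩ : ∃ K' ∈ c, K ⊆ K' ∧ K₁ ⊆ K' := by
      rcases hchain.total hK hK₁ with h | h
      · exact ⟨K₁, hK₁, h, Subset.rfl⟩
      · exact ⟨K, hK, Subset.rfl, h⟩
    obtain ⟨g', hg', hgi', heq⟩ :=
      (hc K hK).exists_injOn_extension (hc K' hK') h1 (hDc n) hDK hg hgi
    exact ⟨⟨⟨K', g'⟩, hK', hDK₁.trans h2, hg', hgi'⟩, heq⟩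
  have hzero : Nonempty (S 0) := by
    classical
    obtain ⟨K, hK, hDK⟩ := hcompact _ (hDc 0) (hDU 0)
    obtain ⟨φ⟩ := (hc K hK).2
    refine ⟨⟨⟨K, fun x => if h : x ∈ K then (φ ⟨x, h⟩ : ℝ) else 0⟩, hK, hDK, ?_, ?_⟩⟩
    · rw [continuousOn_iff_continuous_domRestrict]
      have : (K.domRestrict fun x => if h : x ∈ K then (φ ⟨x, h⟩ : ℝ) else 0) =
          fun x => (φ x : ℝ) := by
        ext x
        simp
      rw [this]
      exact continuous_subtype_val.comp φ.continuous
    · intro x hx y hy hxy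
      simp only [hx, hy, dif_pos] at hxy
      exact congrArg Subtype.val (φ.injective (Subtype.ext hxy))
  choose next hnext using hstep
  let s : ∀ n, S n := fun n => Nat.rec (Classical.choice hzero) (fun n p => next n p) n
  have hs : ∀ n, EqOn (s (n + 1)).1.2 (s n).1.2 (D n) := fun n => hnext n (s n)
  have hs' : ∀ m n, n ≤ m → EqOn (s m).1.2 (s n).1.2 (D n) := by
    intro m n hnm
    induction m, hnm using Nat.le_induction with
    | base => exact fun x _ => rfl
    | succ m hnm ih => exact fun x hx => (hs m (hDmono hnm hx)).trans (ih hx)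
  have hex : ∀ x ∈ ⋃₀ c, ∃ n, x ∈ D n := fun x hx =>
    (hDnhds x hx).imp fun n hn => mem_of_mem_nhds hn
  choose! N hN using hex
  have hF : ∀ n, EqOn (fun x => (s (N x)).1.2 x) (s n).1.2 (D n) := by
    intro n x hx
    rcases le_total n (N x) with h | h
    · exact hs' _ _ h hx
    · exact (hs' _ _ h (hN x (hDU n hx))).symm
  refine isFreeOpenInterval_of_injOn ?_ ?_ ?_ (F := fun x => (s (N x)).1.2 x) ?_ ?_
  · obtain ⟨K, hK⟩ := hne
    exact (hc K hK).nonempty.mono (subset_sUnion_of_mem hK)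
  · obtain ⟨K, hK⟩ := hne
    obtain ⟨x, hx⟩ := (hc K hK).nonempty
    refine isPreconnected_of_forall x fun y ⟨K', hK', hy⟩ => ?_
    rcases hchain.total hK hK' with h | h
    · exact ⟨K', subset_sUnion_of_mem hK', h hx, hy, (hc K' hK').isPreconnected⟩
    · exact ⟨K, subset_sUnion_of_mem hK, hx, h hy, (hc K hK).isPreconnected⟩
  · rintro x ⟨K, hK, hx⟩
    exact ⟨K, hc K hK, hx, subset_sUnion_of_mem hK⟩
  · intro x hx
    obtain ⟨n, hn⟩ := hDnhds x hx
    have h1 : ContinuousAt (s n).1.2 x :=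
      (s n).2.2.2.1.continuousAt (Filter.mem_of_superset hn (s n).2.2.1)
    exact (h1.congr (Filter.mem_of_superset hn fun y hy => (hF n hy).symm)).continuousWithinAt
  · intro x hx y hy hxy
    have hx' := hDmono (le_max_left (N x) (N y)) (hN x hx)
    have hy' := hDmono (le_max_right (N x) (N y)) (hN y hy)
    refine (s (max (N x) (N y))).2.2.2.2 ((s _).2.2.1 hx') ((s _).2.2.1 hy') ?_
    rw [← hF _ hx', ← hF _ hy']
    exact hxy

lemma IsFreeOpenInterval.exists_isMaxFreeOpenInterval [MetricSpace X] [CompactSpace X] {J : Set X}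
    (hJ : IsFreeOpenInterval J) : ∃ K, IsMaxFreeOpenInterval K ∧ J ⊆ K := by
  obtain ⟨K, hJK, hK⟩ := zorn_subset_nonempty {K : Set X | IsFreeOpenInterval K}
    (fun c hc hchain hne => ⟨⋃₀ c, isFreeOpenInterval_sUnion_of_isChain hc hchain hne,
      fun K hK => subset_sUnion_of_mem hK⟩) J hJ
  exact ⟨K, ⟨hK.1, fun L hL hKL => hK.eq_of_subset hL hKL⟩, hJK⟩

/-- In a compact locally connected space the ends of a free open interval converge. -/
lemma exists_tendsto_atTop_of_isOpenEmbedding [TopologicalSpace X] [T2Space X] [CompactSpace X]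
    [LocallyConnectedSpace X] {l : ℝ → X} (hl : IsOpenEmbedding l) :
    ∃ b ∉ range l, Filter.Tendsto l Filter.atTop (𝓝 b) := by
  obtain ⟨b, hb⟩ := exists_clusterPt_of_compactSpace (Filter.map l Filter.atTop)
  have hfreq : ∀ C ∈ 𝓝 b, ∀ M : ℝ, ∃ x > M, l x ∈ C := by
    intro C hC M
    have hb' : MapClusterPt b Filter.atTop l := hb
    obtain ⟨x, hx, hxM⟩ := ((hb'.frequently hC).and_eventually (Filter.eventually_gt_atTop M)).exists
    exact ⟨x, hxM, hx⟩
  have hbr : b ∉ range l := by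
    rintro ⟨r, rfl⟩
    obtain ⟨x, hx, y, hy, hxy⟩ := hfreq (l '' Ioo (r - 1) (r + 1))
      ((hl.isOpenMap _ isOpen_Ioo).mem_nhds ⟨r, by constructor <;> linarith, rfl⟩) (r + 1)
    have := hl.injective hxy
    subst this
    exact lt_asymm hx hy.2
  refine ⟨b, hbr, ?_⟩
  rw [((locallyConnectedSpace_iff_connected_basis.1 inferInstance) b).tendsto_right_iff]
  rintro C ⟨hC, hCpre⟩
  by_contra hcon
  rw [Filter.not_eventually] at hcon
  have hout : ∀ M : ℝ, ∃ x > M, l x ∉ C := fun M => by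
    obtain ⟨x, hx, hxM⟩ := (hcon.and_eventually (Filter.eventually_gt_atTop M)).exists
    exact ⟨x, hxM, hx⟩
  obtain ⟨x, -, hx⟩ := hout 0
  obtain ⟨y, hxy, hy⟩ := hfreq C hC x
  obtain ⟨z, hyz, hz⟩ := hout y
  have hsub : C ⊆ l '' Ioo x z := by
    refine hCpre.subset_left_of_subset_union (v := (l '' Icc x z)ᶜ) (hl.isOpenMap _ isOpen_Ioo)
      (isCompact_Icc.image hl.continuous).isClosed.isOpen_compl ?_ ?_ ⟨l y, hy, y, ⟨hxy, hyz⟩, rfl⟩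
    · exact disjoint_left.2 fun w hw hw' => hw' (image_mono Ioo_subset_Icc_self hw)
    · intro w hw
      by_cases hmem : w ∈ l '' Icc x z
      · obtain ⟨u, hu, rfl⟩ := hmem
        rcases eq_endpoints_or_mem_Ioo_of_mem_Icc hu with rfl | rfl | hu
        · exact absurd hw hx
        · exact absurd hw hz
        · exact Or.inl ⟨u, hu, rfl⟩
      · exact Or.inr hmem
  exact hbr (image_subset_range _ _ (hsub (mem_of_mem_nhds hC)))

lemma tendsto_tan_affine_atTop :
    Filter.Tendsto (fun r : ℝ => Real.tan (Real.pi * (r - 1 / 2))) (𝓝[<] 1) Filter.atTop := by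
  refine Real.tendsto_tan_pi_div_two.comp (tendsto_nhdsWithin_iff.2 ⟨?_, ?_⟩)
  · have : Continuous fun r : ℝ => Real.pi * (r - 1 / 2) := by fun_prop
    have h := this.tendsto 1
    rw [show Real.pi * ((1:ℝ) - 1 / 2) = Real.pi / 2 by ring] at h
    exact h.mono_left nhdsWithin_le_nhds
  · filter_upwards [self_mem_nhdsWithin] with r hr
    have := Real.pi_pos
    simp only [mem_Iio] at hr ⊢
    nlinarith

lemma tendsto_tan_affine_atBot :
    Filter.Tendsto (fun r : ℝ => Real.tan (Real.pi * (r - 1 / 2))) (𝓝[>] 0) Filter.atBot := by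
  refine Real.tendsto_tan_neg_pi_div_two.comp (tendsto_nhdsWithin_iff.2 ⟨?_, ?_⟩)
  · have : Continuous fun r : ℝ => Real.pi * (r - 1 / 2) := by fun_prop
    have h := this.tendsto 0
    rw [show Real.pi * ((0:ℝ) - 1 / 2) = -(Real.pi / 2) by ring] at h
    exact h.mono_left nhdsWithin_le_nhds
  · filter_upwards [self_mem_nhdsWithin] with r hr
    have := Real.pi_pos
    simp only [mem_Ioi] at hr ⊢
    nlinarith

/-- An open line whose two ends converge to points outside it is closed up by these points, and
its closure is an arc when they are distinct. -/
lemma isArcEnds_closure_range [TopologicalSpace X] [T3Space X] {l : ℝ → X}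
    (hl : IsOpenEmbedding l) {a b : X} (ha : a ∉ range l) (hb : b ∉ range l)
    (hla : Filter.Tendsto l Filter.atBot (𝓝 a)) (hlb : Filter.Tendsto l Filter.atTop (𝓝 b)) :
    closure (range l) = range l ∪ {a, b} ∧ (a ≠ b → IsArcEnds (closure (range l)) a b) := by
  have hπ := Real.pi_pos
  set t : ℝ → ℝ := fun r => Real.tan (Real.pi * (r - 1 / 2)) with ht
  have harg : ∀ r ∈ Ioo (0:ℝ) 1, Real.pi * (r - 1 / 2) ∈ Ioo (-(Real.pi / 2)) (Real.pi / 2) := by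
    rintro r ⟨h0, h1⟩
    constructor <;> nlinarith
  have htc : ContinuousOn t (Ioo 0 1) :=
    Real.continuousOn_tan_Ioo.comp (by fun_prop) harg
  have hti : InjOn t (Ioo 0 1) := by
    intro x hx y hy hxy
    have := Real.injOn_tan (harg x hx) (harg y hy) hxy
    have := mul_left_cancel₀ hπ.ne' this
    linarith
  have hts : t '' Ioo 0 1 = univ := by
    refine eq_univ_of_forall fun x => ⟨Real.arctan x / Real.pi + 1 / 2, ?_, ?_⟩
    · have h1 := Real.arctan_lt_pi_div_two x
      have h2 := Real.neg_pi_div_two_lt_arctan x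
      have h3 : Real.arctan x / Real.pi < 1 / 2 := by rw [div_lt_iff₀ hπ]; linarith
      have h4 : -(1 / 2) < Real.arctan x / Real.pi := by rw [lt_div_iff₀ hπ]; linarith
      constructor <;> linarith
    · simp only [ht, add_sub_cancel_right]
      rw [mul_div_cancel₀ _ hπ.ne', Real.tan_arctan]
  set γ := extendFrom (Ioo (0:ℝ) 1) (l ∘ t) with hγ
  have hltc : ContinuousOn (l ∘ t) (Ioo 0 1) := hl.continuous.comp_continuousOn htc
  have h0 : Filter.Tendsto (l ∘ t) (𝓝[>] 0) (𝓝 a) := hla.comp tendsto_tan_affine_atBot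
  have h1 : Filter.Tendsto (l ∘ t) (𝓝[<] 1) (𝓝 b) := hlb.comp tendsto_tan_affine_atTop
  have hγc : ContinuousOn γ (Icc 0 1) := continuousOn_Icc_extendFrom_Ioo hltc h0 h1
  have hγ0 : γ 0 = a := eq_lim_at_left_extendFrom_Ioo zero_lt_one h0
  have hγ1 : γ 1 = b := eq_lim_at_right_extendFrom_Ioo zero_lt_one h1
  have hγt : ∀ r ∈ Ioo (0:ℝ) 1, γ r = l (t r) := extendFrom_extends hltc
  have himg : γ '' Icc 0 1 = range l ∪ {a, b} := by
    refine Subset.antisymm ?_ ?_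
    · rintro _ ⟨r, hr, rfl⟩
      rcases eq_endpoints_or_mem_Ioo_of_mem_Icc hr with rfl | rfl | hr
      · exact Or.inr (Or.inl hγ0)
      · exact Or.inr (Or.inr hγ1)
      · exact Or.inl ⟨t r, (hγt r hr).symm⟩
    · rintro y (⟨x, rfl⟩ | rfl | rfl)
      · obtain ⟨r, hr, rfl⟩ : x ∈ t '' Ioo 0 1 := hts ▸ mem_univ x
        exact ⟨r, Ioo_subset_Icc_self hr, hγt r hr⟩
      · exact ⟨0, by simp, hγ0⟩
      · exact ⟨1, by simp, hγ1⟩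
  have hcl : closure (range l) = range l ∪ {a, b} := by
    refine Subset.antisymm ?_ ?_
    · refine closure_minimal subset_union_left ?_
      rw [← himg]
      exact (isCompact_Icc.image_of_continuousOn hγc).isClosed
    · refine union_subset subset_closure ?_
      rintro y (rfl | rfl)
      · exact mem_closure_of_tendsto hla (.of_forall fun x => mem_range_self x)
      · exact mem_closure_of_tendsto hlb (.of_forall fun x => mem_range_self x)
  refine ⟨hcl, fun hab => ⟨γ, hγc, ?_, himg.trans hcl.symm, hγ0, hγ1⟩⟩
  intro x hx y hy hxy
  rcases eq_endpoints_or_mem_Ioo_of_mem_Icc hx with rfl | rfl | hx <;>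
    rcases eq_endpoints_or_mem_Ioo_of_mem_Icc hy with rfl | rfl | hy
  · rfl
  · exact absurd (hγ0.symm.trans (hxy.trans hγ1)) hab
  · exact absurd ⟨_, ((hγt y hy).symm.trans (hxy.symm.trans hγ0))⟩ ha
  · exact absurd (hγ0.symm.trans (hxy.symm.trans hγ1)) hab
  · rfl
  · exact absurd ⟨_, ((hγt y hy).symm.trans (hxy.symm.trans hγ1))⟩ hb
  · exact absurd ⟨_, ((hγt x hx).symm.trans (hxy.trans hγ0))⟩ ha
  · exact absurd ⟨_, ((hγt x hx).symm.trans (hxy.trans hγ1))⟩ hb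
  · rw [hγt x hx, hγt y hy] at hxy
    exact hti hx hy (hl.injective hxy)

lemma isEndpointOf_of_isOpen_image_Ioc [TopologicalSpace X] [T2Space X] {g : ℝ → X}
    (hc : Continuous g) {s T : ℝ} (hsT : s < T) (hinj : InjOn g (Icc s T))
    (hopen : IsOpen (g '' Ioc s T)) : IsEndpointOf X (g T) := by
  intro U hU hTU
  obtain ⟨u, hu, huU⟩ : ∃ u ∈ Ioo s T, Ioc u T ⊆ g ⁻¹' U := by
    obtain ⟨v, hv, hvU⟩ := exists_Ioc_subset_of_mem_nhds ((hU.preimage hc).mem_nhds hTU) ⟨s, hsT⟩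
    obtain ⟨u, hu1, hu2⟩ := exists_between (max_lt hv hsT)
    exact ⟨u, ⟨(le_max_right _ _).trans_lt hu1, hu2⟩,
      (Ioc_subset_Ioc_left ((le_max_left _ _).trans hu1.le)).trans hvU⟩
  have hVo : IsOpen (g '' Ioc u T) := by
    have : g '' Ioc u T = g '' Ioc s T \ g '' Icc s u := by
      refine Subset.antisymm ?_ ?_
      · rintro _ ⟨x, hx, rfl⟩
        refine ⟨⟨x, ⟨hu.1.trans hx.1, hx.2⟩, rfl⟩, ?_⟩
        rintro ⟨y, hy, hyx⟩
        have := hinj ⟨hy.1, hy.2.trans hu.2.le⟩ ⟨(hu.1.trans hx.1).le, hx.2⟩ hyx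
        exact absurd hx.1 (not_lt.2 (this ▸ hy.2))
      · rintro _ ⟨⟨x, hx, rfl⟩, hx'⟩
        refine ⟨x, ⟨?_, hx.2⟩, rfl⟩
        by_contra! hxu
        exact hx' ⟨x, ⟨hx.1.le, hxu⟩, rfl⟩
    rw [this]
    exact hopen.sdiff (isCompact_Icc.image hc).isClosed
  refine ⟨g '' Ioc u T, hVo, ⟨T, ⟨hu.2, le_rfl⟩, rfl⟩, image_subset_iff.2 huU, g u, ?_⟩
  have hcl : closure (g '' Ioc u T) = g '' Icc u T := by
    refine Subset.antisymm (closure_minimal (image_mono Ioc_subset_Icc_self)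
      (isCompact_Icc.image hc).isClosed) ?_
    rw [← closure_Ioc hu.2.ne]
    exact image_closure_subset_closure_image hc
  rw [hVo.frontier_eq, hcl]
  refine Subset.antisymm ?_ ?_
  · rintro _ ⟨⟨x, hx, rfl⟩, hx'⟩
    rcases hx.1.eq_or_lt with rfl | hux
    · rfl
    · exact absurd ⟨x, ⟨hux, hx.2⟩, rfl⟩ hx'
  · rintro _ rfl
    refine ⟨⟨u, ⟨le_rfl, hu.2.le⟩, rfl⟩, ?_⟩
    rintro ⟨x, hx, hxu⟩
    exact hx.1.ne' (hinj ⟨(hu.1.trans hx.1).le, hx.2⟩ (Ioo_subset_Icc_self hu) hxu)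

/-- A half-open free arc produces a maximal free open interval of Type I. -/
lemma exists_isTypeI [MetricSpace X] [CompactSpace X] [LocallyConnectedSpace X] {g : ℝ → X}
    (hc : Continuous g) (ho : IsOpenMap g) {s T : ℝ} (hsT : s < T) (hinj : InjOn g (Icc s T))
    (hopen : IsOpen (g '' Ioc s T)) : ∃ J : Set X, IsTypeI J := by
  obtain ⟨L, hL, hsub⟩ := (isFreeOpenInterval_image_Ioo hc ho hsT
    (hinj.mono Ioo_subset_Icc_self)).exists_isMaxFreeOpenInterval
  obtain ⟨l, hl, rfl⟩ := isFreeOpenInterval_iff.1 hL.1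
  have hpre : IsPreconnected (l ⁻¹' (g '' Ioo s T)) := by
    rw [← hl.isInducing.isPreconnected_image, image_preimage_eq_inter_range, inter_eq_left.2 hsub]
    exact isPreconnected_Ioo.image g hc.continuousOn
  have hHL : ∀ y ∈ g '' Ioc s T, y ≠ g T → y ∈ g '' Ioo s T := by
    rintro _ ⟨x, hx, rfl⟩ hne
    exact ⟨x, ⟨hx.1, hx.2.lt_of_ne (by rintro rfl; exact hne rfl)⟩, rfl⟩
  have hTnot : g T ∉ g '' Ioo s T := by
    rintro ⟨x, hx, hxT⟩
    exact hx.2.ne (hinj (Ioo_subset_Icc_self hx) ⟨hsT.le, le_rfl⟩ hxT)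
  have hTmem : g T ∈ g '' Ioc s T := ⟨T, ⟨hsT, le_rfl⟩, rfl⟩
  have hTL : g T ∉ range l := by
    rintro ⟨x, hx⟩
    have hN : l ⁻¹' (g '' Ioc s T) ∈ 𝓝 x :=
      hl.continuous.continuousAt (hopen.mem_nhds (hx ▸ hTmem))
    obtain ⟨ε, hε, hb⟩ := Metric.mem_nhds_iff.1 hN
    rw [Real.ball_eq_Ioo] at hb
    have hmem : ∀ y ∈ Ioo (x - ε) (x + ε), y ≠ x → y ∈ l ⁻¹' (g '' Ioo s T) := by
      intro y hy hyx
      refine hHL _ (hb hy) fun h => hyx (hl.injective (h.trans hx.symm))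
    have h1 := hmem (x - ε / 2) ⟨by linarith, by linarith⟩ (by linarith)
    have h2 := hmem (x + ε / 2) ⟨by linarith, by linarith⟩ (by linarith)
    have h3 := hpre.Icc_subset h1 h2 (show x ∈ _ from ⟨by linarith, by linarith⟩)
    rw [mem_preimage, hx] at h3
    exact hTnot h3
  obtain ⟨b, hb, hlb⟩ := exists_tendsto_atTop_of_isOpenEmbedding hl
  obtain ⟨a, ha, hla⟩ := exists_tendsto_atTop_of_isOpenEmbedding
    (hl.comp (Homeomorph.neg ℝ).isOpenEmbedding)
  have hla' : Filter.Tendsto l Filter.atBot (𝓝 a) := by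
    have := hla.comp Filter.tendsto_neg_atBot_atTop
    refine this.congr fun x => ?_
    simp
  have ha' : a ∉ range l := fun h => ha (by
    rw [(Homeomorph.neg ℝ).surjective.range_comp]; exact h)
  have hTcl : g T ∈ closure (g '' Ioo s T) := by
    refine image_closure_subset_closure_image hc ⟨T, ?_, rfl⟩
    rw [closure_Ioo hsT.ne]
    exact ⟨hsT.le, le_rfl⟩
  obtain ⟨hcl, harc⟩ := isArcEnds_closure_range hl ha' hb hla' hlb
  have hab : g T = a → g T = b → False := by
    rintro rfl rfl
    have hN := hopen.mem_nhds hTmem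
    have hunb : ∀ x, x ∈ l ⁻¹' (g '' Ioo s T) := by
      intro x
      obtain ⟨y, hy, hyx⟩ := ((hla'.eventually hN).and (Filter.eventually_le_atBot x)).exists
      obtain ⟨z, hz, hzx⟩ := ((hlb.eventually hN).and (Filter.eventually_ge_atTop x)).exists
      exact hpre.Icc_subset (hHL _ hy fun h => hTL ⟨y, h⟩) (hHL _ hz fun h => hTL ⟨z, h⟩)
        ⟨hyx, hzx⟩
    have hrange : range l ⊆ g '' Ioo s T := by
      rintro _ ⟨x, rfl⟩
      exact hunb x
    have hscl : g s ∈ closure (range l) := by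
      refine closure_mono hsub (image_closure_subset_closure_image hc ⟨s, ?_, rfl⟩)
      rw [closure_Ioo hsT.ne]
      exact ⟨le_rfl, hsT.le⟩
    rw [hcl, pair_eq_singleton] at hscl
    rcases hscl with h | h
    · obtain ⟨x, hx, hxs⟩ := hrange h
      exact hx.1.ne' (hinj (Ioo_subset_Icc_self hx) ⟨le_rfl, hsT.le⟩ hxs)
    · exact hsT.ne (hinj ⟨le_rfl, hsT.le⟩ ⟨hsT.le, le_rfl⟩ h)
  have hend := isEndpointOf_of_isOpen_image_Ioc hc hsT hinj hopen
  have hT : g T = a ∨ g T = b := (hcl ▸ closure_mono hsub hTcl).resolve_left hTL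
  have hne : a ≠ b := by
    rintro rfl
    exact hab (or_self_iff.1 hT) (or_self_iff.1 hT)
  exact ⟨range l, hL, a, b, hne, ha', hb, hcl, harc hne,
    hT.imp (fun h : g T = a => h ▸ hend) (fun h : g T = b => h ▸ hend)⟩

end MaximalFreeOpenIntervals

/-- If `X` (Peano continuum with a free arc, neither arc nor
circle) has no maximal free open interval of Type I, then for a maximal free
open interval `J` and a continuous open map `f : X → X`, there is a maximal free
open interval `K` with `f(J) ⊆ K`, and `f` is injective on `J`. -/
theorem stmt_12 (X : Type*) [MetricSpace X] [CompactSpace X] [ConnectedSpace X]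
    [LocallyConnectedSpace X]
    (hfree : ∃ A : Set X, IsFreeArc A)
    (harc : ¬ SpaceIsArc X) (hcirc : ¬ SpaceIsCircle X)
    (hnoI : ∀ J : Set X, ¬ IsTypeI J)
    (J : Set X) (hJ : IsMaxFreeOpenInterval J)
    (f : X → X) (hc : Continuous f) (ho : IsOpenMap f) :
    ∃ K : Set X, IsMaxFreeOpenInterval K ∧ f '' J ⊆ K ∧ Set.InjOn f J := by
  obtain ⟨γ, hγ, rfl⟩ := isFreeOpenInterval_iff.1 hJ.1
  have hgc : Continuous (f ∘ γ) := hc.comp hγ.continuous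
  have hgo : IsOpenMap (f ∘ γ) := ho.comp hγ.isOpenMap
  by_cases hginj : Function.Injective (f ∘ γ)
  · have hfree' : IsFreeOpenInterval (f '' range γ) := isFreeOpenInterval_iff.2
      ⟨f ∘ γ, .of_continuous_injective_isOpenMap hgc hginj hgo, range_comp f γ⟩
    obtain ⟨K, hK, hsub⟩ := hfree'.exists_isMaxFreeOpenInterval
    refine ⟨K, hK, hsub, ?_⟩
    rintro _ ⟨x, rfl⟩ _ ⟨y, rfl⟩ hxy
    rw [hginj hxy]
  · exfalso
    by_cases hloc : ∀ p, ∃ O, IsOpen O ∧ p ∈ O ∧ InjOn (f ∘ γ) O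
    · exact hcirc (spaceIsCircle_of_not_injective hgc hgo hloc hginj)
    push Not at hloc
    obtain ⟨p, hp⟩ := hloc
    have : Nontrivial X := ⟨γ 0, γ 1, fun h => zero_ne_one (hγ.injective h)⟩
    obtain ⟨z, hz⟩ := exists_ne ((f ∘ γ) p)
    have hN : (f ∘ γ) ⁻¹' {z}ᶜ ∈ 𝓝 p :=
      hgc.continuousAt (isOpen_compl_singleton.mem_nhds hz.symm)
    obtain ⟨ε, hε, hball⟩ := Metric.nhds_basis_closedBall.mem_iff.1 hN
    rw [Real.closedBall_eq_Icc] at hball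
    have huniv : (f ∘ γ) '' Icc (p - ε) (p + ε) ≠ univ := by
      intro h
      obtain ⟨x, hx, hxz⟩ := h ▸ mem_univ z
      exact hball hx hxz
    have hnot := hp (Ioo (p - ε) (p + ε)) isOpen_Ioo ⟨by linarith, by linarith⟩
    obtain ⟨s, hs, t, ht, hst, heq⟩ : ∃ s ∈ Ioo (p - ε) (p + ε), ∃ t ∈ Ioo (p - ε) (p + ε),
        s < t ∧ (f ∘ γ) s = (f ∘ γ) t := by
      rw [InjOn] at hnot
      push Not at hnot
      obtain ⟨s, hs, t, ht, heq, hne⟩ := hnot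
      rcases lt_or_gt_of_ne hne with h | h
      · exact ⟨s, hs, t, ht, h, heq⟩
      · exact ⟨t, ht, s, hs, h, heq.symm⟩
    obtain ⟨T, hsT, hinj, hopen⟩ := exists_fold hgc hgo huniv hs.1 hst ht.2 heq
    obtain ⟨L, hL⟩ := exists_isTypeI hgc hgo hsT hinj hopen
    exact hnoI L hL
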